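/- arXiv:1207.2369 — 3 statements merged into one kernel-verified Lean document; each statement's English description precedes it below -/
import Mathlib

section
/- Let f : I ⊆ [0,∞) → ℝ be differentiable on I° with f' integrable on [a,b], where a,b ∈ I° with a < b, and suppose |f'|^q is (α,m)-convex on [a,b] for (α,m) ∈ (0,1]² with mb > a and q ≥ 1. Set δ₃* = (2 + 3^{α+1}(2α+1)) / (6^{α+2}(α+1)(α+2)) and β₁* = (2·5^{α+2} + 6^{α+1}(α−4) − 3^{α+1}(2α+7)) / (6^{α+2}(α+1)(α+2)). Then |(1/6)[f(a) + 4f((a+mb)/2) + f(mb)] − (1/(mb−a)) ∫ₐ^{mb} f(x) dx| ≤ (mb−a)(5/72)^{1−1/q} [ (δ₃*|f'(a)|^q + m(5/72 − δ₃*)|f'(b)|^q)^{1/q} + (β₁*|f'(a)|^q + m(5/72 − β₁*)|f'(b)|^q)^{1/q} ]. -/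
open MeasureTheory Set Real

/-- A function `g` is `(α,m)`-convex on `s` if
`g (t*x + m*(1-t)*y) ≤ t^α * g x + m*(1-t^α) * g y` for all `x, y ∈ s` and `t ∈ [0,1]`. -/
def AlphaMConvexOn (s : Set ℝ) (α m : ℝ) (g : ℝ → ℝ) : Prop :=
  ∀ x ∈ s, ∀ y ∈ s, ∀ t ∈ Icc (0:ℝ) 1,
    g (t * x + m * (1 - t) * y) ≤ t ^ α * g x + m * (1 - t ^ α) * g y

/-- The weighted power mean inequality for integrals. -/
theorem integral_mul_rpow_le {w φ : ℝ → ℝ} {c d p : ℝ} (hcd : c ≤ d) (hp0 : 0 < p) (hp1 : p ≤ 1)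
    (hw : Continuous w) (hφ : ContinuousOn φ (Icc c d)) (hw0 : ∀ t, 0 ≤ w t)
    (hφ0 : ∀ t ∈ Icc c d, 0 ≤ φ t) (hW : 0 < ∫ t in c..d, w t) :
    ∫ t in c..d, w t * φ t ^ p
      ≤ (∫ t in c..d, w t) ^ (1 - p) * (∫ t in c..d, w t * φ t) ^ p := by
  have hwi : IntervalIntegrable w volume c d := hw.intervalIntegrable c d
  have hwφ : IntervalIntegrable (fun t => w t * φ t) volume c d :=
    (hw.continuousOn.mul hφ).intervalIntegrable_of_Icc hcd
  have hwφp : IntervalIntegrable (fun t => w t * φ t ^ p) volume c d :=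
    (hw.continuousOn.mul
      (hφ.rpow_const fun _ _ => Or.inr hp0.le)).intervalIntegrable_of_Icc hcd
  have hΦ0 : 0 ≤ ∫ t in c..d, w t * φ t :=
    intervalIntegral.integral_nonneg hcd fun t ht => mul_nonneg (hw0 t) (hφ0 t ht)
  set W := ∫ t in c..d, w t with hWdef
  set Φ := ∫ t in c..d, w t * φ t with hΦdef
  rcases hΦ0.eq_or_lt with hΦ | hΦ
  · have hae : (fun t => w t * φ t) =ᵐ[volume.restrict (Ioc c d)] 0 := by
      refine (intervalIntegral.integral_eq_zero_iff_of_le_of_nonneg_ae hcd ?_ hwφ).1 hΦ.symm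
      filter_upwards [ae_restrict_mem measurableSet_Ioc] with t ht
      exact mul_nonneg (hw0 t) (hφ0 t (Ioc_subset_Icc_self ht))
    have hzero : ∫ t in c..d, w t * φ t ^ p = 0 := by
      rw [intervalIntegral.integral_of_le hcd]
      refine integral_eq_zero_of_ae ?_
      filter_upwards [hae] with t ht
      rcases mul_eq_zero.1 ht with h | h
      · simp [h]
      · simp [h, zero_rpow hp0.ne']
    rw [hzero]
    positivity
  · have hM : 0 < Φ / W := div_pos hΦ hW
    set M := Φ / W with hMdef
    have tangent : ∀ t ∈ Icc c d,
        w t * φ t ^ p ≤ (M ^ p * (1 - p)) * w t + (M ^ p * p / M) * (w t * φ t) := by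
      intro t ht
      have hφt := hφ0 t ht
      have h1 : (1 + (φ t / M - 1)) ^ p ≤ 1 + p * (φ t / M - 1) := by
        refine rpow_one_add_le_one_add_mul_self ?_ hp0.le hp1
        have : 0 ≤ φ t / M := by positivity
        linarith
      have h2 : φ t ^ p = M ^ p * (1 + (φ t / M - 1)) ^ p := by
        rw [← mul_rpow hM.le (by ring_nf; positivity)]
        congr 1
        field_simp
        ring
      rw [h2]
      calc w t * (M ^ p * (1 + (φ t / M - 1)) ^ p)
          ≤ w t * (M ^ p * (1 + p * (φ t / M - 1))) := by
            gcongr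
            exact hw0 t
        _ = _ := by ring
    calc ∫ t in c..d, w t * φ t ^ p
        ≤ ∫ t in c..d, (M ^ p * (1 - p)) * w t + (M ^ p * p / M) * (w t * φ t) :=
          intervalIntegral.integral_mono_on hcd hwφp
            ((hwi.const_mul _).add (hwφ.const_mul _)) tangent
      _ = (M ^ p * (1 - p)) * W + (M ^ p * p / M) * Φ := by
          rw [intervalIntegral.integral_add (hwi.const_mul _) (hwφ.const_mul _),
            intervalIntegral.integral_const_mul, intervalIntegral.integral_const_mul]
      _ = M ^ p * W := by
          have : Φ = M * W := by rw [hMdef]; field_simp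
          rw [this]
          field_simp
          ring
      _ = W ^ (1 - p) * Φ ^ p := by
          rw [hMdef, div_rpow hΦ.le hW.le, rpow_sub hW, rpow_one]
          ring

theorem integral_sub_mul_rpow {u v e α : ℝ} (hα : 0 ≤ α) (hu : 0 ≤ u) (hv : 0 ≤ v) :
    ∫ t in u..v, (t - e) * t ^ α
      = (v ^ α * v ^ 2 / (α + 2) - e * (v ^ α * v) / (α + 1))
        - (u ^ α * u ^ 2 / (α + 2) - e * (u ^ α * u) / (α + 1)) := by
  have hpow1 : ∀ x : ℝ, 0 ≤ x → x ^ (α + 1) = x ^ α * x := fun x hx =>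
    rpow_add_one' hx (by positivity)
  have hpow2 : ∀ x : ℝ, 0 ≤ x → x ^ (α + 1 + 1) = x ^ α * x ^ 2 := fun x hx => by
    rw [rpow_add_one' hx (by positivity), hpow1 x hx]
    ring
  have hcongr : ∫ t in u..v, (t - e) * t ^ α = ∫ t in u..v, (t ^ (α + 1) - e * t ^ α) := by
    refine intervalIntegral.integral_congr fun t ht => ?_
    have ht0 : 0 ≤ t := (le_inf hu hv).trans ht.1
    simp only [hpow1 t ht0]
    ring
  rw [hcongr, intervalIntegral.integral_sub
    (intervalIntegral.intervalIntegrable_rpow' (by linarith))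
    ((intervalIntegral.intervalIntegrable_rpow' (by linarith)).const_mul _),
    intervalIntegral.integral_const_mul, integral_rpow (Or.inl (by linarith)),
    integral_rpow (Or.inl (by linarith)), hpow1 u hu, hpow1 v hv, hpow2 u hu, hpow2 v hv,
    add_assoc α 1 1, one_add_one_eq_two]
  ring

theorem integral_abs_sub_mul_rpow {c e d α : ℝ} (hα : 0 ≤ α) (hc : 0 ≤ c) (hce : c ≤ e)
    (hed : e ≤ d) :
    ∫ t in c..d, |t - e| * t ^ α
      = (d ^ α * d ^ 2 / (α + 2) - e * (d ^ α * d) / (α + 1))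
        + (c ^ α * c ^ 2 / (α + 2) - e * (c ^ α * c) / (α + 1))
        - 2 * (e ^ α * e ^ 2 / (α + 2) - e * (e ^ α * e) / (α + 1)) := by
  have hcont : Continuous fun t : ℝ => |t - e| * t ^ α :=
    (continuous_id.sub continuous_const).abs.mul (continuous_rpow_const hα)
  have hleft : ∫ t in c..e, |t - e| * t ^ α = -∫ t in c..e, (t - e) * t ^ α := by
    rw [← intervalIntegral.integral_neg]
    refine intervalIntegral.integral_congr fun t ht => ?_
    rw [uIcc_of_le hce] at ht
    simp only [abs_of_nonpos (sub_nonpos.2 ht.2), neg_mul]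
  have hright : ∫ t in e..d, |t - e| * t ^ α = ∫ t in e..d, (t - e) * t ^ α := by
    refine intervalIntegral.integral_congr fun t ht => ?_
    rw [uIcc_of_le hed] at ht
    simp only [abs_of_nonneg (sub_nonneg.2 ht.1)]
  rw [← intervalIntegral.integral_add_adjacent_intervals (hcont.intervalIntegrable c e)
    (hcont.intervalIntegrable e d), hleft, hright,
    integral_sub_mul_rpow hα hc (hc.trans hce),
    integral_sub_mul_rpow hα (hc.trans hce) (hc.trans (hce.trans hed))]
  ring

theorem integral_abs_sub_one_sixth :
    ∫ t in (0:ℝ)..(1 / 2), |t - 1 / 6| = 5 / 72 := by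
  have h := integral_abs_sub_mul_rpow (c := 0) (e := 1 / 6) (d := 1 / 2) le_rfl le_rfl
    (by norm_num) (by norm_num)
  simp only [rpow_zero, mul_one] at h
  rw [h]
  norm_num

theorem integral_abs_sub_five_sixths :
    ∫ t in (1 / 2 : ℝ)..1, |t - 5 / 6| = 5 / 72 := by
  have h := integral_abs_sub_mul_rpow (c := 1 / 2) (e := 5 / 6) (d := 1) le_rfl (by norm_num)
    (by norm_num) (by norm_num)
  simp only [rpow_zero, mul_one] at h
  rw [h]
  norm_num

theorem integral_abs_sub_one_sixth_mul_rpow {α : ℝ} (hα : 0 < α) :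
    ∫ t in (0:ℝ)..(1 / 2), |t - 1 / 6| * t ^ α
      = (2 + 3 ^ (α + 1) * (2 * α + 1)) / (6 ^ (α + 2) * (α + 1) * (α + 2)) := by
  rw [integral_abs_sub_mul_rpow hα.le le_rfl (by norm_num) (by norm_num)]
  have h2 : (1 / 2 : ℝ) ^ α = 3 ^ α / 6 ^ α := by
    rw [← div_rpow (by norm_num) (by norm_num)]
    norm_num
  have h6 : (1 / 6 : ℝ) ^ α = 1 / 6 ^ α := by
    rw [div_rpow (by norm_num) (by norm_num), one_rpow]
  rw [h2, h6, rpow_add (by norm_num : (0:ℝ) < 3), rpow_add (by norm_num : (0:ℝ) < 6), rpow_one,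
    rpow_two]
  have : (0:ℝ) < 6 ^ α := by positivity
  field_simp
  ring

theorem integral_abs_sub_five_sixths_mul_rpow {α : ℝ} (hα : 0 < α) :
    ∫ t in (1 / 2 : ℝ)..1, |t - 5 / 6| * t ^ α
      = (2 * 5 ^ (α + 2) + 6 ^ (α + 1) * (α - 4) - 3 ^ (α + 1) * (2 * α + 7))
        / (6 ^ (α + 2) * (α + 1) * (α + 2)) := by
  rw [integral_abs_sub_mul_rpow hα.le (by norm_num) (by norm_num) (by norm_num)]
  have h2 : (1 / 2 : ℝ) ^ α = 3 ^ α / 6 ^ α := by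
    rw [← div_rpow (by norm_num) (by norm_num)]
    norm_num
  have h6 : (5 / 6 : ℝ) ^ α = 5 ^ α / 6 ^ α := div_rpow (by norm_num) (by norm_num) _
  rw [h2, h6, one_rpow, rpow_add (by norm_num : (0:ℝ) < 3), rpow_add (by norm_num : (0:ℝ) < 6),
    rpow_add (by norm_num : (0:ℝ) < 6), rpow_add (by norm_num : (0:ℝ) < 5), rpow_one, rpow_one,
    rpow_two, rpow_two]
  have : (0:ℝ) < 6 ^ α := by positivity
  field_simp
  ring

/-- Simpson's rule on `[0,1]` expressed through the derivative by means of the Peano kernel. -/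
theorem simpson_eq_integral_kernel {F F' : ℝ → ℝ}
    (hF : ∀ t ∈ Icc (0:ℝ) 1, HasDerivAt F (F' t) t) (hF' : IntervalIntegrable F' volume 0 1) :
    (1 / 6) * (F 0 + 4 * F (1 / 2) + F 1) - ∫ t in (0:ℝ)..1, F t
      = (∫ t in (0:ℝ)..(1 / 2), (t - 1 / 6) * F' t)
        + ∫ t in (1 / 2 : ℝ)..1, (t - 5 / 6) * F' t := by
  have parts : ∀ u v e : ℝ, 0 ≤ u → u ≤ v → v ≤ 1 →
      ∫ t in u..v, (t - e) * F' t = (v - e) * F v - (u - e) * F u - ∫ t in u..v, F t := by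
    intro u v e hu huv hv
    have hsub : uIcc u v ⊆ Icc 0 1 := by
      rw [uIcc_of_le huv]
      exact Icc_subset_Icc hu hv
    rw [intervalIntegral.integral_mul_deriv_eq_deriv_mul (u' := fun _ => 1)
      (u := fun t => t - e) (fun t _ => (hasDerivAt_id' t).sub_const e) (fun t ht => hF t (hsub ht))
      intervalIntegrable_const
      (hF'.mono_set (by rwa [uIcc_of_le (zero_le_one' ℝ)]))]
    simp
  have hcont : ContinuousOn F (Icc 0 1) := fun t ht => (hF t ht).continuousAt.continuousWithinAt
  rw [parts 0 (1 / 2) (1 / 6) le_rfl (by norm_num) (by norm_num),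
    parts (1 / 2) 1 (5 / 6) (by norm_num) (by norm_num) le_rfl,
    ← intervalIntegral.integral_add_adjacent_intervals (b := 1 / 2)
      ((hcont.mono (Icc_subset_Icc le_rfl (by norm_num))).intervalIntegrable_of_Icc (by norm_num))
      ((hcont.mono (Icc_subset_Icc (by norm_num) le_rfl)).intervalIntegrable_of_Icc (by norm_num))]
  ring

/-- Power mean bound for a kernel integral whose other factor has an `(α,m)`-convex majorant. -/
theorem abs_integral_sub_mul_le {G : ℝ → ℝ} {c d e α m q h A B W D : ℝ} (hc : 0 ≤ c)
    (hcd : c ≤ d) (hd : d ≤ 1) (hα : 0 < α) (hm : 0 ≤ m) (hq : 1 ≤ q) (hh : 0 ≤ h) (hA : 0 ≤ A)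
    (hB : 0 ≤ B) (hG : ∀ t ∈ Icc c d, |G t| ≤ h * (t ^ α * A + m * (1 - t ^ α) * B) ^ (1 / q))
    (hW : ∫ t in c..d, |t - e| = W) (hW0 : 0 < W)
    (hD : ∫ t in c..d, |t - e| * t ^ α = D) :
    |∫ t in c..d, (t - e) * G t|
      ≤ h * W ^ (1 - 1 / q) * (D * A + m * (W - D) * B) ^ (1 / q) := by
  have hq0 : 0 < q := by linarith
  have hw : Continuous fun t : ℝ => |t - e| := (continuous_id.sub continuous_const).abs
  have hpow : Continuous fun t : ℝ => t ^ α := continuous_rpow_const hα.le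
  have hφ : Continuous fun t : ℝ => t ^ α * A + m * (1 - t ^ α) * B := by fun_prop
  have hφ0 : ∀ t ∈ Icc c d, 0 ≤ t ^ α * A + m * (1 - t ^ α) * B := by
    intro t ht
    have ht0 : 0 ≤ t := hc.trans ht.1
    have ht1 : 0 ≤ 1 - t ^ α := sub_nonneg.2 (rpow_le_one ht0 (ht.2.trans hd) hα.le)
    positivity
  have hmean := integral_mul_rpow_le hcd (one_div_pos.2 hq0) ((div_le_one hq0).2 hq) hw
    hφ.continuousOn (fun t => abs_nonneg _) hφ0 (hW ▸ hW0)
  have hmoment : ∫ t in c..d, |t - e| * (t ^ α * A + m * (1 - t ^ α) * B)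
      = D * A + m * (W - D) * B := by
    have hi1 : IntervalIntegrable (fun t : ℝ => |t - e| * t ^ α) volume c d :=
      (hw.mul hpow).intervalIntegrable c d
    have hi2 : IntervalIntegrable (fun t : ℝ => |t - e|) volume c d := hw.intervalIntegrable c d
    have hsplit : ∀ t : ℝ, |t - e| * (t ^ α * A + m * (1 - t ^ α) * B)
        = (A - m * B) * (|t - e| * t ^ α) + m * B * |t - e| := fun t => by ring
    simp only [hsplit]
    rw [intervalIntegral.integral_add (hi1.const_mul _) (hi2.const_mul _),
      intervalIntegral.integral_const_mul, intervalIntegral.integral_const_mul, hW, hD]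
    ring
  rw [hmoment, hW] at hmean
  have hbound : |∫ t in c..d, (t - e) * G t|
      ≤ ∫ t in c..d, h * (|t - e| * (t ^ α * A + m * (1 - t ^ α) * B) ^ (1 / q)) := by
    rw [← norm_eq_abs]
    refine intervalIntegral.norm_integral_le_of_norm_le hcd (ae_of_all _ fun t ht => ?_) ?_
    · rw [norm_mul, norm_eq_abs, norm_eq_abs, mul_left_comm]
      exact mul_le_mul_of_nonneg_left (hG t (Ioc_subset_Icc_self ht)) (abs_nonneg _)
    · exact (continuous_const.mul (hw.mul (hφ.rpow_const fun _ =>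
        Or.inr (one_div_pos.2 hq0).le))).intervalIntegrable c d
  rw [intervalIntegral.integral_const_mul] at hbound
  calc _ ≤ _ := hbound
    _ ≤ h * (W ^ (1 - 1 / q) * (D * A + m * (W - D) * B) ^ (1 / q)) := by gcongr
    _ = _ := by ring

theorem simpson_power_mean (I : Set ℝ) (hI : I.OrdConnected) (hI0 : I ⊆ Ici (0:ℝ))
    (f f' : ℝ → ℝ) (a b m α q : ℝ)
    (ha : a ∈ interior I) (hb : b ∈ interior I) (hab : a < b)
    (hα : α ∈ Ioc (0:ℝ) 1) (hm : m ∈ Ioc (0:ℝ) 1) (hmb : a < m * b) (hq : 1 ≤ q)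
    (hdiff : ∀ x ∈ interior I, HasDerivAt f (f' x) x)
    (hint : IntervalIntegrable f' volume a b)
    (hconv : AlphaMConvexOn (Icc a b) α m (fun x => |f' x| ^ q))
    (δ3s β1s : ℝ)
    (hδ3s : δ3s = (2 + 3 ^ (α + 1) * (2 * α + 1)) / (6 ^ (α + 2) * (α + 1) * (α + 2)))
    (hβ1s : β1s = (2 * 5 ^ (α + 2) + 6 ^ (α + 1) * (α - 4) - 3 ^ (α + 1) * (2 * α + 7))
        / (6 ^ (α + 2) * (α + 1) * (α + 2))) :
    |(1 / 6) * (f a + 4 * f ((a + m * b) / 2) + f (m * b))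
        - (1 / (m * b - a)) * ∫ x in a..(m * b), f x|
      ≤ (m * b - a) * (5 / 72 : ℝ) ^ (1 - 1 / q) *
        ((δ3s * |f' a| ^ q + m * (5 / 72 - δ3s) * |f' b| ^ q) ^ (1 / q)
          + (β1s * |f' a| ^ q + m * (5 / 72 - β1s) * |f' b| ^ q) ^ (1 / q)) := by
  have hm0 := hm.1
  have hb0 : 0 ≤ b := hI0 (interior_subset hb)
  have hmb' : m * b ≤ b := mul_le_of_le_one_left hb0 hm.2
  have hh : 0 < m * b - a := sub_pos.2 hmb
  have hq0 : 0 < q := by linarith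
  have hmaps : ∀ t ∈ Icc (0:ℝ) 1, m * b - (m * b - a) * t ∈ Icc a b := fun t ht =>
    ⟨by nlinarith [ht.2], by nlinarith [ht.1]⟩
  have hIcc : Icc a b ⊆ interior I := hI.interior.out ha hb
  have hderiv : ∀ t ∈ Icc (0:ℝ) 1, HasDerivAt (fun t => f (m * b - (m * b - a) * t))
      (-(m * b - a) * f' (m * b - (m * b - a) * t)) t := by
    intro t ht
    have hinner : HasDerivAt (fun t : ℝ => m * b - (m * b - a) * t) (-(m * b - a)) t := by
      simpa using ((hasDerivAt_id t).const_mul (m * b - a)).const_sub (m * b)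
    rw [mul_comm (-(m * b - a))]
    exact (hdiff _ (hIcc (hmaps t ht))).comp t hinner
  have hint' : IntervalIntegrable
      (fun t => -(m * b - a) * f' (m * b - (m * b - a) * t)) volume 0 1 := by
    have hsub : IntervalIntegrable f' volume (m * b) a := by
      refine hint.mono_set ?_
      rw [uIcc_of_ge hmb.le, uIcc_of_le hab.le]
      exact Icc_subset_Icc le_rfl hmb'
    have hcomp := (hsub.comp_sub_left (m * b)).comp_mul_left (c := m * b - a)
    rw [sub_self, zero_div, div_self hh.ne'] at hcomp
    exact hcomp.const_mul _
  have hsimpson := simpson_eq_integral_kernel hderiv hint'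
  have hmean : ∫ t in (0:ℝ)..1, f (m * b - (m * b - a) * t)
      = (1 / (m * b - a)) * ∫ x in a..(m * b), f x := by
    rw [intervalIntegral.integral_comp_sub_mul _ hh.ne']
    simp
  rw [hmean] at hsimpson
  have hlhs : (1 / 6) * (f a + 4 * f ((a + m * b) / 2) + f (m * b))
      = (1 / 6) * (f (m * b - (m * b - a) * 0) + 4 * f (m * b - (m * b - a) * (1 / 2))
        + f (m * b - (m * b - a) * 1)) := by
    rw [show m * b - (m * b - a) * (1 / 2) = (a + m * b) / 2 by ring,
      show m * b - (m * b - a) * 1 = a by ring, show m * b - (m * b - a) * 0 = m * b by ring]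
    ring
  have hG : ∀ t ∈ Icc (0:ℝ) 1, |(-(m * b - a) * f' (m * b - (m * b - a) * t))|
      ≤ (m * b - a) * (t ^ α * |f' a| ^ q + m * (1 - t ^ α) * |f' b| ^ q) ^ (1 / q) := by
    intro t ht
    have hcv := hconv a (left_mem_Icc.2 hab.le) b (right_mem_Icc.2 hab.le) t ht
    rw [show t * a + m * (1 - t) * b = m * b - (m * b - a) * t by ring] at hcv
    rw [abs_mul, abs_neg, abs_of_pos hh]
    refine mul_le_mul_of_nonneg_left ?_ hh.le
    calc |f' (m * b - (m * b - a) * t)|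
        = (|f' (m * b - (m * b - a) * t)| ^ q) ^ (1 / q) := by
          rw [one_div, rpow_rpow_inv (abs_nonneg _) hq0.ne']
      _ ≤ _ := rpow_le_rpow (by positivity) hcv (by positivity)
  have hA : 0 ≤ |f' a| ^ q := by positivity
  have hB : 0 ≤ |f' b| ^ q := by positivity
  have hleft := abs_integral_sub_mul_le le_rfl (by norm_num) (by norm_num) hα.1 hm0.le hq hh.le
    hA hB (fun t ht => hG t ⟨ht.1, ht.2.trans (by norm_num)⟩) integral_abs_sub_one_sixth
    (by norm_num) ((integral_abs_sub_one_sixth_mul_rpow hα.1).trans hδ3s.symm)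
  have hright := abs_integral_sub_mul_le (by norm_num) (by norm_num) le_rfl hα.1 hm0.le hq hh.le
    hA hB (fun t ht => hG t ⟨le_trans (by norm_num) ht.1, ht.2⟩) integral_abs_sub_five_sixths
    (by norm_num) ((integral_abs_sub_five_sixths_mul_rpow hα.1).trans hβ1s.symm)
  rw [hlhs, hsimpson, mul_add]
  exact (abs_add_le _ _).trans (add_le_add hleft hright)
end

section
/- Let f : I ⊆ [0,∞) → ℝ be differentiable on I° with f' integrable on [a,b], where a,b ∈ I° with a < b, and suppose |f'|^q is (α,m)-convex on [a,b] for (α,m) ∈ (0,1]² with mb > a and q ≥ 1. Then |f((a+mb)/2) − (1/(mb−a)) ∫ₐ^{mb} f(x) dx| ≤ (mb−a)(1/8)^{1−1/q} [ ( (1/(2^{α+2}(α+2)))|f'(a)|^q + m(1/8 − 1/(2^{α+2}(α+2)))|f'(b)|^q )^{1/q} + ( ((2^{α+2}−α−3)/(2^{α+2}(α+1)(α+2)))|f'(a)|^q + m(1/8 − (2^{α+2}−α−3)/(2^{α+2}(α+1)(α+2)))|f'(b)|^q )^{1/q} ]. -/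
open MeasureTheory Set Real

/-- The power mean inequality for weighted integrals: if `h ^ q ≤ C` on `[u, v]` then
`∫ w h ≤ (∫ w) ^ (1 - 1 / q) * (∫ w C) ^ (1 / q)`. -/
theorem integral_mul_le_power_mean {u v q : ℝ} (huv : u ≤ v) (hq : 1 ≤ q) {w h C : ℝ → ℝ}
    (hw : ∀ t ∈ Icc u v, 0 ≤ w t) (hh : ∀ t ∈ Icc u v, 0 ≤ h t)
    (hC : ∀ t ∈ Icc u v, h t ^ q ≤ C t)
    (hwi : IntervalIntegrable w volume u v)
    (hwh : IntervalIntegrable (fun t => w t * h t) volume u v)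
    (hwC : IntervalIntegrable (fun t => w t * C t) volume u v)
    (hW : 0 < ∫ t in u..v, w t) :
    ∫ t in u..v, w t * h t
      ≤ (∫ t in u..v, w t) ^ (1 - 1 / q) * (∫ t in u..v, w t * C t) ^ (1 / q) := by
  have hq0 : 0 < q := by linarith
  have young : ∀ s : ℝ, 0 < s → q * (∫ t in u..v, w t * h t) / s ≤
      (∫ t in u..v, w t * C t) / s ^ q + (q - 1) * ∫ t in u..v, w t := by
    intro s hs
    have hsq : 0 < s ^ q := rpow_pos_of_pos hs q
    have := intervalIntegral.integral_mono_on huv (hwh.const_mul (q / s))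
      ((hwC.const_mul (1 / s ^ q)).add (hwi.const_mul (q - 1))) (fun t ht => by
        have h1 := one_add_mul_self_le_rpow_one_add (s := h t / s - 1) (by
          have := div_nonneg (hh t ht) hs.le
          linarith) hq
        rw [add_sub_cancel, div_rpow (hh t ht) hs.le] at h1
        have h2 : h t ^ q / s ^ q ≤ C t / s ^ q := by
          gcongr
          exact hC t ht
        have h3 : q * (h t / s) ≤ C t / s ^ q + (q - 1) := by linarith
        have h4 := mul_le_mul_of_nonneg_left h3 (hw t ht)
        calc q / s * (w t * h t) = w t * (q * (h t / s)) := by ring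
          _ ≤ _ := h4
          _ = 1 / s ^ q * (w t * C t) + (q - 1) * w t := by ring)
    rw [intervalIntegral.integral_add (hwC.const_mul _) (hwi.const_mul _),
      intervalIntegral.integral_const_mul, intervalIntegral.integral_const_mul,
      intervalIntegral.integral_const_mul] at this
    calc _ = q / s * ∫ t in u..v, w t * h t := by ring
      _ ≤ _ := this
      _ = _ := by ring
  have hK : 0 ≤ ∫ t in u..v, w t * C t := intervalIntegral.integral_nonneg huv fun t ht =>
    mul_nonneg (hw t ht) ((rpow_nonneg (hh t ht) q).trans (hC t ht))
  set K := ∫ t in u..v, w t * C t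
  set W := ∫ t in u..v, w t
  set X := ∫ t in u..v, w t * h t
  rcases hK.eq_or_lt with hK0 | hKpos
  · rw [← hK0, zero_rpow (by positivity), mul_zero]
    by_contra! hX
    have hs : 0 < X / W := by positivity
    have := young (X / W) hs
    rw [← hK0, zero_div, zero_add, div_div_eq_mul_div, div_le_iff₀ hX] at this
    nlinarith [mul_pos hX hW]
  · have hs : 0 < (K / W) ^ (1 / q) := by positivity
    have := young _ hs
    rw [← rpow_mul (by positivity), one_div_mul_cancel hq0.ne', rpow_one,
      div_div_cancel₀ hKpos.ne', div_le_iff₀ hs] at this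
    have hX : X ≤ W * (K / W) ^ (1 / q) := by
      refine le_of_mul_le_mul_left ?_ hq0
      linarith
    refine hX.trans_eq ?_
    rw [div_rpow hK hW.le, rpow_sub hW, rpow_one]
    ring

/-- Integration by parts with the Peano kernel of the midpoint rule on `[0, 1]`. -/
theorem midpoint_sub_integral_eq {g g' : ℝ → ℝ}
    (hg : ∀ t ∈ Icc (0 : ℝ) 1, HasDerivAt g (g' t) t)
    (hg' : IntervalIntegrable g' volume 0 1) :
    g (1 / 2) - ∫ t in (0 : ℝ)..1, g t
      = (∫ t in (0 : ℝ)..(1 / 2), t * g' t) - ∫ t in (1 / 2 : ℝ)..1, (1 - t) * g' t := by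
  have hs1 : uIcc (0 : ℝ) (1 / 2) ⊆ Icc 0 1 := by
    rw [uIcc_of_le (by norm_num)]; exact Icc_subset_Icc_right (by norm_num)
  have hs2 : uIcc (1 / 2 : ℝ) 1 ⊆ Icc 0 1 := by
    rw [uIcc_of_le (by norm_num)]; exact Icc_subset_Icc_left (by norm_num)
  have hu : uIcc (0 : ℝ) 1 = Icc 0 1 := uIcc_of_le zero_le_one
  have hcont : ContinuousOn g (Icc 0 1) := fun t ht => (hg t ht).continuousAt.continuousWithinAt
  have e1 := intervalIntegral.integral_mul_deriv_eq_deriv_mul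
    (a := (0 : ℝ)) (b := 1 / 2) (u := fun t => t) (u' := fun _ => 1) (v := g) (v' := g')
    (fun t _ => hasDerivAt_id t) (fun t ht => hg t (hs1 ht)) intervalIntegrable_const
    (hg'.mono_set (hu ▸ hs1))
  have e2 := intervalIntegral.integral_mul_deriv_eq_deriv_mul
    (a := (1 / 2 : ℝ)) (b := 1) (u := fun t => 1 - t) (u' := fun _ => -1) (v := g) (v' := g')
    (fun t _ => (hasDerivAt_id t).const_sub 1) (fun t ht => hg t (hs2 ht))
    intervalIntegrable_const (hg'.mono_set (hu ▸ hs2))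
  have e3 := intervalIntegral.integral_add_adjacent_intervals (μ := volume)
    (hcont.mono hs1).intervalIntegrable (hcont.mono hs2).intervalIntegrable
  simp only [one_mul, neg_one_mul, intervalIntegral.integral_neg] at e1 e2
  rw [e1, e2, ← e3]
  ring

theorem integral_mul_rpow_zero_half {α : ℝ} (hα : 0 < α) :
    ∫ t in (0 : ℝ)..(1 / 2), t * t ^ α = 1 / (2 ^ (α + 2) * (α + 2)) := by
  have h : ∀ t ∈ uIcc (0 : ℝ) (1 / 2), t * t ^ α = t ^ (α + 1) := fun t ht => by
    rw [uIcc_of_le (by norm_num)] at ht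
    rw [rpow_add_one' ht.1 (by positivity), mul_comm]
  rw [intervalIntegral.integral_congr h, integral_rpow (Or.inl (by linarith)),
    zero_rpow (by linarith), show α + 1 + 1 = α + 2 by ring, one_div (2 : ℝ),
    inv_rpow zero_le_two]
  field_simp
  ring

theorem integral_one_sub_mul_rpow_half_one {α : ℝ} (hα : 0 < α) :
    ∫ t in (1 / 2 : ℝ)..1, (1 - t) * t ^ α
      = (2 ^ (α + 2) - α - 3) / (2 ^ (α + 2) * (α + 1) * (α + 2)) := by
  have h : ∀ t ∈ uIcc (1 / 2 : ℝ) 1, (1 - t) * t ^ α = t ^ α - t ^ (α + 1) := fun t ht => by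
    rw [uIcc_of_le (by norm_num)] at ht
    rw [rpow_add_one' (by linarith [ht.1]) (by positivity)]
    ring
  have h2 : (2 : ℝ) ^ (α + 2) = 2 ^ (α + 1) * 2 := by
    rw [← rpow_add_one two_ne_zero]
    ring_nf
  rw [intervalIntegral.integral_congr h, intervalIntegral.integral_sub
    (intervalIntegral.intervalIntegrable_rpow' (by linarith))
    (intervalIntegral.intervalIntegrable_rpow' (by linarith)),
    integral_rpow (Or.inl (by linarith)), integral_rpow (Or.inl (by linarith)),
    show α + 1 + 1 = α + 2 by ring, one_div (2 : ℝ),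
    inv_rpow zero_le_two, inv_rpow zero_le_two, one_rpow, one_rpow, h2]
  have : (2 : ℝ) ^ (α + 1) ≠ 0 := by positivity
  generalize (2 : ℝ) ^ (α + 1) = p at *
  field_simp
  ring

theorem integral_mul_rpow_combination {u v α J A B m : ℝ} {w : ℝ → ℝ} (hα : 0 < α)
    (hw : Continuous w) (hW : ∫ t in u..v, w t = 1 / 8) (hJ : ∫ t in u..v, w t * t ^ α = J) :
    ∫ t in u..v, w t * (t ^ α * A + m * (1 - t ^ α) * B) = J * A + m * (1 / 8 - J) * B := by
  have hp : Continuous fun t : ℝ => t ^ α := continuous_id.rpow_const fun _ => Or.inr hα.le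
  have hi : IntervalIntegrable (fun t => w t * t ^ α) volume u v :=
    (hw.mul hp).intervalIntegrable u v
  have h : ∀ t, w t * (t ^ α * A + m * (1 - t ^ α) * B)
      = (A - m * B) * (w t * t ^ α) + m * B * w t := fun t => by ring
  simp only [h]
  rw [intervalIntegral.integral_add (hi.const_mul _) ((hw.intervalIntegrable u v).const_mul _),
    intervalIntegral.integral_const_mul, intervalIntegral.integral_const_mul, hW, hJ]
  ring

theorem midpoint_power_mean (I : Set ℝ) (hI : I.OrdConnected) (hI0 : I ⊆ Ici (0:ℝ))
    (f f' : ℝ → ℝ) (a b m α q : ℝ)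
    (ha : a ∈ interior I) (hb : b ∈ interior I) (hab : a < b)
    (hα : α ∈ Ioc (0:ℝ) 1) (hm : m ∈ Ioc (0:ℝ) 1) (hmb : a < m * b) (hq : 1 ≤ q)
    (hdiff : ∀ x ∈ interior I, HasDerivAt f (f' x) x)
    (hint : IntervalIntegrable f' volume a b)
    (hconv : AlphaMConvexOn (Icc a b) α m (fun x => |f' x| ^ q)) :
    |f ((a + m * b) / 2) - (1 / (m * b - a)) * ∫ x in a..(m * b), f x|
      ≤ (m * b - a) * (1 / 8 : ℝ) ^ (1 - 1 / q) *
        (((1 / (2 ^ (α + 2) * (α + 2))) * |f' a| ^ q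
            + m * (1 / 8 - 1 / (2 ^ (α + 2) * (α + 2))) * |f' b| ^ q) ^ (1 / q)
          + (((2 ^ (α + 2) - α - 3) / (2 ^ (α + 2) * (α + 1) * (α + 2))) * |f' a| ^ q
            + m * (1 / 8 - (2 ^ (α + 2) - α - 3) / (2 ^ (α + 2) * (α + 1) * (α + 2)))
              * |f' b| ^ q) ^ (1 / q)) := by
  have ha0 : 0 ≤ a := hI0 (interior_subset ha)
  have hmb' : m * b ≤ b := by nlinarith [hm.2]
  have hd : 0 < m * b - a := sub_pos.2 hmb
  have hc : a - m * b ≠ 0 := by linarith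
  set φ : ℝ → ℝ := fun t => (a - m * b) * t + m * b with hφ
  have hφmem : ∀ t ∈ Icc (0 : ℝ) 1, φ t ∈ Icc a b := fun t ht => by
    constructor <;> simp only [hφ] <;> nlinarith [ht.1, ht.2]
  have hsub : Icc a b ⊆ interior I := hI.interior.out ha hb
  have hφint : IntervalIntegrable (fun t => f' (φ t)) volume 0 1 := by
    have h1 : IntervalIntegrable f' volume (m * b) a :=
      (hint.mono_set (by
        rw [uIcc_of_le hmb.le, uIcc_of_le hab.le]
        exact Icc_subset_Icc_right hmb')).symm
    have h2 := (h1.comp_add_right (m * b)).comp_mul_left (c := a - m * b)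
    simpa [hφ, hc] using h2
  have hderiv : ∀ t ∈ Icc (0 : ℝ) 1,
      HasDerivAt (fun t => f (φ t)) ((a - m * b) * f' (φ t)) t := fun t ht => by
    have h1 : HasDerivAt φ (a - m * b) t :=
      (hasDerivAt_const_mul (a - m * b)).add_const (m * b)
    rw [mul_comm]
    exact (hdiff _ (hsub (hφmem t ht))).comp t h1
  have hbound : ∀ t ∈ Icc (0 : ℝ) 1,
      |f' (φ t)| ^ q ≤ t ^ α * |f' a| ^ q + m * (1 - t ^ α) * |f' b| ^ q := fun t ht => by
    have := hconv a (left_mem_Icc.2 hab.le) b (right_mem_Icc.2 hab.le) t ht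
    rwa [show t * a + m * (1 - t) * b = φ t by simp only [hφ]; ring] at this
  have hid := midpoint_sub_integral_eq hderiv (hφint.const_mul _)
  have hmid : φ (1 / 2) = (a + m * b) / 2 := by simp only [hφ]; ring
  have hsubst : ∫ t in (0 : ℝ)..1, f (φ t) = 1 / (m * b - a) * ∫ x in a..(m * b), f x := by
    simp only [hφ]
    rw [intervalIntegral.integral_comp_mul_add f hc, intervalIntegral.integral_symm]
    simp only [mul_zero, zero_add, mul_one, sub_add_cancel, smul_eq_mul]
    rw [← neg_sub, inv_neg]
    ring
  simp only [hmid, hsubst, mul_left_comm _ (a - m * b), intervalIntegral.integral_const_mul] at hid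
  have key : ∀ {u v J : ℝ} {w : ℝ → ℝ}, u ≤ v → Icc u v ⊆ Icc 0 1 → Continuous w →
      (∀ t ∈ Icc u v, 0 ≤ w t) → ∫ t in u..v, w t = 1 / 8 → ∫ t in u..v, w t * t ^ α = J →
      |∫ t in u..v, w t * f' (φ t)| ≤ (1 / 8 : ℝ) ^ (1 - 1 / q) *
        (J * |f' a| ^ q + m * (1 / 8 - J) * |f' b| ^ q) ^ (1 / q) := by
    intro u v J w huv hs hw hw0 hW hJ
    have hp : Continuous fun t : ℝ => t ^ α := continuous_id.rpow_const fun _ => Or.inr hα.1.le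
    have hi : IntervalIntegrable (fun t => f' (φ t)) volume u v :=
      hφint.mono_set (by rwa [uIcc_of_le huv, uIcc_of_le zero_le_one])
    have hpm := integral_mul_le_power_mean huv hq hw0 (fun t _ => abs_nonneg (f' (φ t)))
      (fun t ht => hbound t (hs ht)) (hw.intervalIntegrable u v)
      (hi.abs.continuousOn_mul hw.continuousOn)
      (Continuous.intervalIntegrable (by fun_prop) u v) (by rw [hW]; norm_num)
    rw [hW, integral_mul_rpow_combination hα.1 hw hW hJ] at hpm
    refine (intervalIntegral.abs_integral_le_integral_abs huv).trans (le_of_eq_of_le ?_ hpm)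
    refine intervalIntegral.integral_congr fun t ht => ?_
    rw [uIcc_of_le huv] at ht
    simp only [abs_mul, abs_of_nonneg (hw0 t ht)]
  have k1 := key (u := 0) (v := 1 / 2) (w := fun t => t) (by norm_num)
    (Icc_subset_Icc_right (by norm_num)) continuous_id (fun t ht => ht.1)
    (by rw [integral_id]; norm_num) (integral_mul_rpow_zero_half hα.1)
  have k2 := key (u := 1 / 2) (v := 1) (w := fun t => 1 - t) (by norm_num)
    (Icc_subset_Icc_left (by norm_num)) (by fun_prop) (fun t ht => sub_nonneg.2 ht.2)
    (by
      rw [intervalIntegral.integral_sub intervalIntegrable_const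
        intervalIntegral.intervalIntegrable_id, integral_id]
      norm_num)
    (integral_one_sub_mul_rpow_half_one hα.1)
  rw [hid, ← mul_sub, abs_mul, abs_sub_comm a, abs_of_pos hd, mul_assoc, mul_add]
  exact mul_le_mul_of_nonneg_left ((abs_sub _ _).trans (add_le_add k1 k2)) hd.le
end

section
/- Let f : I ⊆ [0,∞) → ℝ be differentiable on I° with f' integrable on [a,b], where a,b ∈ I° with a < b, and suppose |f'|^q is convex on [a,b], where q > 1 and 1/p + 1/q = 1. Then |(1/6)[f(a) + 4f((a+b)/2) + f(b)] − (1/(b−a)) ∫ₐ^{b} f(x) dx| ≤ ((b−a)/12)((1+2^{p+1})/(3(p+1)))^{1/p} [ ((|f'((a+b)/2)|^q + |f'(a)|^q)/2)^{1/q} + ((|f'((a+b)/2)|^q + |f'(b)|^q)/2)^{1/q} ]. -/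
open MeasureTheory Set Real

/-- The upper Hermite–Hadamard bound. -/
theorem ConvexOn.intervalIntegral_le_mul_average_endpoints {F : ℝ → ℝ} {c d : ℝ} (hcd : c < d)
    (hF : ConvexOn ℝ (Icc c d) F) (hint : IntervalIntegrable F volume c d) :
    ∫ x in c..d, F x ≤ (d - c) * ((F c + F d) / 2) := by
  have hpos : 0 < d - c := sub_pos.2 hcd
  have hchord : ∀ x ∈ Icc c d, F x ≤ F c + (F d - F c) / (d - c) * (x - c) := by
    intro x hx
    have h := hF.2 (left_mem_Icc.2 hcd.le) (right_mem_Icc.2 hcd.le)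
      (div_nonneg (sub_nonneg.2 hx.2) hpos.le) (div_nonneg (sub_nonneg.2 hx.1) hpos.le)
      (by field_simp; ring)
    simp only [smul_eq_mul] at h
    have hcomb : (d - x) / (d - c) * c + (x - c) / (d - c) * d = x := by
      field_simp; ring
    rw [hcomb] at h
    refine h.trans_eq ?_
    field_simp; ring
  calc ∫ x in c..d, F x
      ≤ ∫ x in c..d, (F c + (F d - F c) / (d - c) * (x - c)) :=
        intervalIntegral.integral_mono_on hcd.le hint
          (Continuous.intervalIntegrable (by fun_prop) _ _) hchord
    _ = (d - c) * ((F c + F d) / 2) := by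
        rw [intervalIntegral.integral_add (by simp)
          (Continuous.intervalIntegrable (by fun_prop) _ _),
          intervalIntegral.integral_const_mul, intervalIntegral.integral_sub (by simp) (by simp)]
        simp only [intervalIntegral.integral_const, integral_id, smul_eq_mul]
        field_simp; ring

theorem ConvexOn.le_max_endpoints_of_mem_Icc {F : ℝ → ℝ} {c d x : ℝ}
    (hF : ConvexOn ℝ (Icc c d) F) (hx : x ∈ Icc c d) : F x ≤ max (F c) (F d) :=
  hF.le_max_of_mem_Icc (left_mem_Icc.2 (hx.1.trans hx.2)) (right_mem_Icc.2 (hx.1.trans hx.2)) hx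

theorem integral_abs_sub_rpow {c d e p : ℝ} (hp : 0 < p) (he : e ∈ Icc c d) :
    ∫ x in c..d, |x - e| ^ p = ((e - c) ^ (p + 1) + (d - e) ^ (p + 1)) / (p + 1) := by
  have hcont : Continuous fun x : ℝ => |x - e| ^ p :=
    (by fun_prop : Continuous fun x : ℝ => |x - e|).rpow_const fun _ => Or.inr hp.le
  rw [← intervalIntegral.integral_add_adjacent_intervals
    (hcont.intervalIntegrable c e) (hcont.intervalIntegrable e d)]
  have h1 : ∫ x in c..e, |x - e| ^ p = ∫ x in c..e, (e - x) ^ p := by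
    refine intervalIntegral.integral_congr fun x hx => ?_
    rw [uIcc_of_le he.1] at hx
    simp only [abs_sub_comm x e, abs_of_nonneg (sub_nonneg.2 hx.2)]
  have h2 : ∫ x in e..d, |x - e| ^ p = ∫ x in e..d, (x - e) ^ p := by
    refine intervalIntegral.integral_congr fun x hx => ?_
    rw [uIcc_of_le he.2] at hx
    simp only [abs_of_nonneg (sub_nonneg.2 hx.1)]
  rw [h1, h2, intervalIntegral.integral_comp_sub_left (fun x => x ^ p),
    intervalIntegral.integral_comp_sub_right (fun x => x ^ p),
    integral_rpow (Or.inl (by linarith)), integral_rpow (Or.inl (by linarith)),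
    sub_self, Real.zero_rpow (by linarith)]
  ring

theorem abs_integral_sub_mul_le_of_convexOn_rpow {g : ℝ → ℝ} {c d e p q : ℝ} (hcd : c < d)
    (he : e ∈ Icc c d) (hpq : p.HolderConjugate q) (hint : IntervalIntegrable g volume c d)
    (hconv : ConvexOn ℝ (Icc c d) fun x => |g x| ^ q) :
    |∫ x in c..d, (x - e) * g x| ≤
      (((e - c) ^ (p + 1) + (d - e) ^ (p + 1)) / (p + 1)) ^ (1 / p) *
        ((d - c) * ((|g c| ^ q + |g d| ^ q) / 2)) ^ (1 / q) := by
  have hq := hpq.symm.pos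
  set M : ℝ := max (|g c| ^ q) (|g d| ^ q)
  have hbound : ∀ x ∈ Icc c d, |g x| ≤ M ^ q⁻¹ := fun x hx =>
    (Real.le_rpow_inv_iff_of_pos (abs_nonneg _)
      ((Real.rpow_nonneg (abs_nonneg _) _).trans (le_max_left _ _)) hq).2
      (hconv.le_max_endpoints_of_mem_Icc hx)
  have hae : ∀ᵐ x ∂volume.restrict (Ioc c d), ‖|g x|‖ ≤ M ^ q⁻¹ := by
    filter_upwards [ae_restrict_mem measurableSet_Ioc] with x hx
    rw [norm_eq_abs, abs_abs]
    exact hbound x (Ioc_subset_Icc_self hx)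
  have hgmeas : AEStronglyMeasurable (fun x => |g x|) (volume.restrict (Ioc c d)) :=
    hint.1.aestronglyMeasurable.norm
  have hgLq : MemLp (fun x => |g x|) (ENNReal.ofReal q) (volume.restrict (Ioc c d)) :=
    MemLp.of_bound hgmeas _ hae
  have hkLp : MemLp (fun x => |x - e|) (ENNReal.ofReal p) (volume.restrict (Ioc c d)) := by
    refine MemLp.of_bound (by fun_prop) (d - c) ?_
    filter_upwards [ae_restrict_mem measurableSet_Ioc] with x hx
    rw [norm_eq_abs, abs_abs, abs_le]
    constructor <;> linarith [hx.1, hx.2, he.1, he.2]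
  have hFint : IntervalIntegrable (fun x => |g x| ^ q) volume c d := by
    rw [intervalIntegrable_iff_integrableOn_Ioc_of_le hcd.le]
    have h := hgLq.integrable_norm_rpow (by simpa using hq) ENNReal.ofReal_ne_top
    simpa [ENNReal.toReal_ofReal hq.le, IntegrableOn] using h
  have hholder := integral_mul_le_Lp_mul_Lq_of_nonneg hpq
    (Filter.Eventually.of_forall fun x => abs_nonneg (x - e))
    (Filter.Eventually.of_forall fun x => abs_nonneg (g x)) hkLp hgLq
  simp only [← intervalIntegral.integral_of_le hcd.le] at hholder
  rw [integral_abs_sub_rpow hpq.pos he] at hholder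
  calc |∫ x in c..d, (x - e) * g x|
      ≤ ∫ x in c..d, |(x - e) * g x| := intervalIntegral.abs_integral_le_integral_abs hcd.le
    _ = ∫ x in c..d, |x - e| * |g x| := by simp only [abs_mul]
    _ ≤ _ := hholder
    _ ≤ _ := by
        have hk : 0 ≤ ((e - c) ^ (p + 1) + (d - e) ^ (p + 1)) / (p + 1) :=
          div_nonneg (add_nonneg (rpow_nonneg (sub_nonneg.2 he.1) _)
            (rpow_nonneg (sub_nonneg.2 he.2) _)) (by linarith [hpq.pos])
        refine mul_le_mul_of_nonneg_left (rpow_le_rpow ?_ ?_ (by positivity)) (rpow_nonneg hk _)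
        · exact intervalIntegral.integral_nonneg hcd.le fun x _ => by positivity
        · exact hconv.intervalIntegral_le_mul_average_endpoints hcd hFint

theorem integral_sub_mul_deriv {f f' : ℝ → ℝ} {c d : ℝ} (e : ℝ)
    (hderiv : ∀ x ∈ uIcc c d, HasDerivAt f (f' x) x) (hint : IntervalIntegrable f' volume c d) :
    ∫ x in c..d, (x - e) * f' x = (d - e) * f d - (c - e) * f c - ∫ x in c..d, f x := by
  simpa using intervalIntegral.integral_mul_deriv_eq_deriv_mul
    (fun x _ => (hasDerivAt_id x).sub_const e) hderiv (by simp) hint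

theorem simpson_weight_rpow_identity {h p q A : ℝ} (hh : 0 < h) (hpq : p.HolderConjugate q)
    (hA : 0 ≤ A) :
    (((h / 6) ^ (p + 1) + (h / 3) ^ (p + 1)) / (p + 1)) ^ (1 / p) * (h / 2 * A) ^ (1 / q) =
      h * (h / 12 * ((1 + 2 ^ (p + 1)) / (3 * (p + 1))) ^ (1 / p) * A ^ (1 / q)) := by
  have hp := hpq.pos
  have h3 : h / 3 = h / 6 * 2 := by ring
  have hbase : ((h / 6) ^ (p + 1) + (h / 3) ^ (p + 1)) / (p + 1) =
      (h / 6) ^ p * (h / 2 * ((1 + 2 ^ (p + 1)) / (3 * (p + 1)))) := by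
    rw [h3, mul_rpow (by positivity) (by norm_num), rpow_add_one (by positivity) p]
    field_simp
    ring
  have hsum : 1 / p + 1 / q = 1 := by simpa using hpq.inv_add_inv_eq_one
  have hhalf : (h / 2) ^ (1 / p) * (h / 2) ^ (1 / q) = h / 2 := by
    rw [← rpow_add (by positivity), hsum, rpow_one]
  rw [hbase, mul_rpow (by positivity) (by positivity), mul_rpow (by positivity) (by positivity),
    mul_rpow (by positivity) hA, ← rpow_mul (by positivity), mul_one_div_cancel hp.ne', rpow_one]
  linear_combination (h / 6 * ((1 + 2 ^ (p + 1)) / (3 * (p + 1))) ^ (1 / p) * A ^ (1 / q)) * hhalf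

theorem simpson_holder_convex (I : Set ℝ) (hI : I.OrdConnected) (hI0 : I ⊆ Ici (0:ℝ))
    (f f' : ℝ → ℝ) (a b p q : ℝ)
    (ha : a ∈ interior I) (hb : b ∈ interior I) (hab : a < b)
    (hq : 1 < q) (hpq : 1 / p + 1 / q = 1)
    (hdiff : ∀ x ∈ interior I, HasDerivAt f (f' x) x)
    (hint : IntervalIntegrable f' volume a b)
    (hconv : ConvexOn ℝ (Icc a b) (fun x => |f' x| ^ q)) :
    |(1 / 6) * (f a + 4 * f ((a + b) / 2) + f b)
        - (1 / (b - a)) * ∫ x in a..b, f x|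
      ≤ ((b - a) / 12) * ((1 + 2 ^ (p + 1)) / (3 * (p + 1))) ^ (1 / p) *
        (((|f' ((a + b) / 2)| ^ q + |f' a| ^ q) / 2) ^ (1 / q)
          + ((|f' ((a + b) / 2)| ^ q + |f' b| ^ q) / 2) ^ (1 / q)) := by
  have hpq' : p.HolderConjugate q :=
    (Real.holderConjugate_iff.2 ⟨hq, by simpa [add_comm] using hpq⟩ : q.HolderConjugate p).symm
  have hderiv : ∀ x ∈ Icc a b, HasDerivAt f (f' x) x := fun x hx =>
    hdiff x (hI.interior.out ha hb hx)
  have hh : 0 < b - a := sub_pos.2 hab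
  set m := (a + b) / 2 with hm
  have ham : a < m := by linarith
  have hmb : m < b := by linarith
  have hl : Icc a m ⊆ Icc a b := Icc_subset_Icc_right hmb.le
  have hr : Icc m b ⊆ Icc a b := Icc_subset_Icc_left ham.le
  have hintl : IntervalIntegrable f' volume a m :=
    hint.mono_set (by rwa [uIcc_of_le ham.le, uIcc_of_le hab.le])
  have hintr : IntervalIntegrable f' volume m b :=
    hint.mono_set (by rwa [uIcc_of_le hmb.le, uIcc_of_le hab.le])
  have hcont : ContinuousOn f (Icc a b) := fun x hx => (hderiv x hx).continuousAt.continuousWithinAt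
  have hsplit := intervalIntegral.integral_add_adjacent_intervals
    ((hcont.mono hl).intervalIntegrable_of_Icc (μ := volume) ham.le)
    ((hcont.mono hr).intervalIntegrable_of_Icc (μ := volume) hmb.le)
  have hpartsl := integral_sub_mul_deriv (a + (b - a) / 6)
    (fun x hx => hderiv x (hl (by rwa [uIcc_of_le ham.le] at hx))) hintl
  have hpartsr := integral_sub_mul_deriv (b - (b - a) / 6)
    (fun x hx => hderiv x (hr (by rwa [uIcc_of_le hmb.le] at hx))) hintr
  have hboundl := abs_integral_sub_mul_le_of_convexOn_rpow (e := a + (b - a) / 6) ham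
    ⟨by linarith, by linarith⟩ hpq' hintl (hconv.subset hl (convex_Icc _ _))
  have hboundr := abs_integral_sub_mul_le_of_convexOn_rpow (e := b - (b - a) / 6) hmb
    ⟨by linarith, by linarith⟩ hpq' hintr (hconv.subset hr (convex_Icc _ _))
  rw [show a + (b - a) / 6 - a = (b - a) / 6 by ring,
    show m - (a + (b - a) / 6) = (b - a) / 3 by rw [hm]; ring,
    show m - a = (b - a) / 2 by rw [hm]; ring, add_comm (|f' a| ^ q),
    simpson_weight_rpow_identity hh hpq' (by positivity)] at hboundl
  rw [show b - (b - a) / 6 - m = (b - a) / 3 by rw [hm]; ring,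
    show b - (b - (b - a) / 6) = (b - a) / 6 by ring,
    show b - m = (b - a) / 2 by rw [hm]; ring, add_comm (((b - a) / 3) ^ (p + 1)),
    simpson_weight_rpow_identity hh hpq' (by positivity)] at hboundr
  have hkey : (1 / 6) * (f a + 4 * f m + f b) - (1 / (b - a)) * ∫ x in a..b, f x =
      ((∫ x in a..m, (x - (a + (b - a) / 6)) * f' x) +
        ∫ x in m..b, (x - (b - (b - a) / 6)) * f' x) / (b - a) := by
    rw [hpartsl, hpartsr, ← hsplit]
    field_simp
    rw [hm]
    ring
  rw [hkey, abs_div, abs_of_pos hh, div_le_iff₀ hh]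
  refine (abs_add_le _ _).trans ((add_le_add hboundl hboundr).trans_eq ?_)
  ring
end
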